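/- Let t₀ ∈ ℝ, α ∈ (0,1), p ∈ (1,∞), 0 < ν < μ, let Ω ⊂ ℝ^d be measurable, and let u ∈ L_p((−∞,t₀)×Ω). Let η : ℝ → ℝ be a Lipschitz function with η(t) = 1 for t ≥ t₀−ν, η(t) = 0 for t ≤ t₀−μ, and |η′(t)| ≤ 2/(μ−ν). Define G(t,x) = (α/Γ(1−α)) ∫_{−∞}^t (t−s)^{−α−1}(η(s) − η(t)) u(s,x) ds, and let {s_k}_{k≥1} be a sequence with s₁ = μ, s_k + μ ≤ s_{k+1}, and s_{k+1}/N₀ ≤ s_k for some N₀ > 0. Then ‖G‖_{L_p((t₀−μ,t₀)×Ω)} ≤ [2αμ^{1−α} / ((1−α)Γ(1−α)(μ−ν))] (∫_{t₀−2μ}^{t₀−ν} ∫_Ω |u(t,x)|^p dx dt)^{1/p} + [α(N₀^{α+1}+1)/Γ(1−α)] Σ_{k=1}^∞ s_k^{−α−1}(s_{k+1}−s_k)^{1−1/p} μ^{1/p} (∫_{t₀−s_{k+1}}^{t₀−s_k} ∫_Ω |u(s,x)|^p dx ds)^{1/p}. -/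

import Mathlib

open MeasureTheory Real

noncomputable section

open scoped ENNReal

theorem lintegral_Lp_sum_le {X : Type*} [MeasurableSpace X] {m : Measure X} {p : ℝ} (hp : 1 ≤ p)
    {f : ℕ → X → ℝ≥0∞} (hf : ∀ n, Measurable (f n)) (N : ℕ) :
    (∫⁻ x, (∑ n ∈ Finset.range N, f n x) ^ p ∂m) ^ (1 / p) ≤
      ∑ n ∈ Finset.range N, (∫⁻ x, f n x ^ p ∂m) ^ (1 / p) := by
  have hp0 : 0 < p := by linarith
  induction N with
  | zero => simp [hp0]
  | succ N ih =>
    simp only [Finset.sum_range_succ]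
    refine (ENNReal.lintegral_Lp_add_le (f := fun x => ∑ n ∈ Finset.range N, f n x) (g := f N)
      (by fun_prop) (hf N).aemeasurable hp).trans ?_
    gcongr

/-- Minkowski's inequality for countable sums of `ℝ≥0∞`-valued functions. -/
theorem lintegral_Lp_tsum_le {X : Type*} [MeasurableSpace X] {m : Measure X} {p : ℝ} (hp : 1 ≤ p)
    {f : ℕ → X → ℝ≥0∞} (hf : ∀ n, Measurable (f n)) :
    (∫⁻ x, (∑' n, f n x) ^ p ∂m) ^ (1 / p) ≤ ∑' n, (∫⁻ x, f n x ^ p ∂m) ^ (1 / p) := by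
  have hp0 : 0 < p := by linarith
  have hmono : Monotone fun (N : ℕ) (x : X) => (∑ n ∈ Finset.range N, f n x) ^ p := by
    intro a b hab x
    dsimp only
    gcongr
  have hsup : ∀ x, (∑' n, f n x) ^ p = ⨆ N : ℕ, (∑ n ∈ Finset.range N, f n x) ^ p := fun x => by
    rw [ENNReal.tsum_eq_iSup_nat]
    exact (ENNReal.orderIsoRpow p hp0).map_iSup _
  simp_rw [hsup]
  rw [lintegral_iSup (fun N => by fun_prop) hmono,
    ← ENNReal.le_rpow_inv_iff (by positivity)]
  refine iSup_le fun N => ?_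
  rw [ENNReal.le_rpow_inv_iff (by positivity)]
  exact (lintegral_Lp_sum_le hp hf N).trans (ENNReal.sum_le_tsum _)

/-- Schur test with Hölder-type constants for an integral operator acting in the first variable. -/
theorem lintegral_Lp_schur_le {T S X : Type*} [MeasurableSpace T] [MeasurableSpace S]
    [MeasurableSpace X] {τ : Measure T} {σ : Measure S} {ρ : Measure X} [SFinite τ] [SFinite σ]
    [SFinite ρ] {p : ℝ} (hp : 1 < p) {K : T × S → ℝ≥0∞} (hK : Measurable K)
    {w : S × X → ℝ≥0∞} (hw : Measurable w) {A B : ℝ≥0∞}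
    (hA : ∀ᵐ s ∂σ, ∫⁻ t, K (t, s) ∂τ ≤ A) (hB : ∀ᵐ t ∂τ, ∫⁻ s, K (t, s) ∂σ ≤ B) :
    (∫⁻ z, (∫⁻ s, K (z.1, s) * w (s, z.2) ∂σ) ^ p ∂(τ.prod ρ)) ^ (1 / p) ≤
      B ^ (1 - 1 / p) * A ^ (1 / p) * (∫⁻ z, w z ^ p ∂(σ.prod ρ)) ^ (1 / p) := by
  have hp0 : 0 < p := by linarith
  have hpq : p.HolderConjugate p.conjExponent := Real.HolderConjugate.conjExponent hp
  set q := p.conjExponent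
  have hq : 1 / q = 1 - 1 / p := by
    have := hpq.inv_add_inv_eq_one
    simp only [one_div]; linarith
  have hq0 : 0 < q := hpq.symm.pos
  have key : ∀ t x, ∫⁻ s, K (t, s) ∂σ ≤ B → (∫⁻ s, K (t, s) * w (s, x) ∂σ) ^ p ≤
      B ^ (p - 1) * ∫⁻ s, K (t, s) * w (s, x) ^ p ∂σ := by
    intro t x ht
    have h1 := ENNReal.lintegral_mul_le_Lp_mul_Lq σ hpq.symm
      (f := fun s => K (t, s) ^ (1 / q)) (g := fun s => K (t, s) ^ (1 / p) * w (s, x))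
      (by fun_prop) (by fun_prop)
    have h2 : ∀ s, ((fun s => K (t, s) ^ (1 / q)) * fun s => K (t, s) ^ (1 / p) * w (s, x)) s =
        K (t, s) * w (s, x) := fun s => by
      simp only [Pi.mul_apply]
      rw [← mul_assoc, ← ENNReal.rpow_add_of_nonneg _ _ (by positivity) (by positivity), hq]
      simp
    have h3 : ∀ s, (K (t, s) ^ (1 / p) * w (s, x)) ^ p = K (t, s) * w (s, x) ^ p := fun s => by
      rw [ENNReal.mul_rpow_of_nonneg _ _ hp0.le, ← ENNReal.rpow_mul, one_div_mul_cancel hp0.ne',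
        ENNReal.rpow_one]
    have h4 : ∀ s, (K (t, s) ^ (1 / q)) ^ q = K (t, s) := fun s => by
      rw [← ENNReal.rpow_mul, one_div_mul_cancel hq0.ne', ENNReal.rpow_one]
    simp only [h2, h3, h4] at h1
    calc (∫⁻ s, K (t, s) * w (s, x) ∂σ) ^ p
        ≤ (B ^ (1 / q) * (∫⁻ s, K (t, s) * w (s, x) ^ p ∂σ) ^ (1 / p)) ^ p := by
          gcongr
          exact h1.trans (by gcongr)
      _ = _ := by
          rw [ENNReal.mul_rpow_of_nonneg _ _ hp0.le, ← ENNReal.rpow_mul, ← ENNReal.rpow_mul,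
            one_div_mul_cancel hp0.ne', ENNReal.rpow_one, hq, sub_mul, one_div_mul_cancel hp0.ne',
            one_mul]
  have hmeas : Measurable fun r : (T × X) × S => K (r.1.1, r.2) * w (r.2, r.1.2) ^ p := by
    fun_prop
  have hprod : ∫⁻ z, ∫⁻ s, K (z.1, s) * w (s, z.2) ^ p ∂σ ∂(τ.prod ρ) ≤
      A * ∫⁻ z, w z ^ p ∂(σ.prod ρ) := by
    rw [lintegral_prod_symm' _ hmeas.lintegral_prod_right',
      lintegral_prod_symm' _ (by fun_prop), ← lintegral_const_mul _ (by fun_prop)]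
    refine lintegral_mono fun x => ?_
    rw [lintegral_lintegral_swap (by fun_prop), ← lintegral_const_mul _ (by fun_prop)]
    refine lintegral_mono_ae ?_
    filter_upwards [hA] with s hs
    rw [lintegral_mul_const _ (by fun_prop)]
    gcongr
  have hB' : ∀ᵐ z ∂(τ.prod ρ), ∫⁻ s, K (z.1, s) ∂σ ≤ B :=
    Measure.quasiMeasurePreserving_fst.ae hB
  calc (∫⁻ z, (∫⁻ s, K (z.1, s) * w (s, z.2) ∂σ) ^ p ∂(τ.prod ρ)) ^ (1 / p)
      ≤ (B ^ (p - 1) * (A * ∫⁻ z, w z ^ p ∂(σ.prod ρ))) ^ (1 / p) := by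
        gcongr
        refine (lintegral_mono_ae (hB'.mono fun z hz => key z.1 z.2 hz)).trans ?_
        rw [lintegral_const_mul _ hmeas.lintegral_prod_right']
        gcongr
    _ = _ := by
        rw [ENNReal.mul_rpow_of_nonneg _ _ (by positivity),
          ENNReal.mul_rpow_of_nonneg _ _ (by positivity), ← ENNReal.rpow_mul, mul_assoc, sub_mul,
          mul_one_div_cancel hp0.ne', one_mul]

theorem rpow_neg_le_chord {a b r β : ℝ} (ha : 0 < a) (har : a ≤ r) (hrb : r ≤ b) (hab : a < b)
    (hβ : 0 ≤ β) :
    r ^ (-β) ≤ (b - r) / (b - a) * a ^ (-β) + (r - a) / (b - a) * b ^ (-β) := by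
  have hb : 0 < b := ha.trans hab
  have hba : 0 < b - a := by linarith
  have h1 : 0 ≤ (b - r) / (b - a) := div_nonneg (by linarith) hba.le
  have h2 : 0 ≤ (r - a) / (b - a) := div_nonneg (by linarith) hba.le
  have h3 : (b - r) / (b - a) + (r - a) / (b - a) = 1 := by field_simp; ring
  have h4 : (b - r) / (b - a) * a + (r - a) / (b - a) * b = r := by field_simp; ring
  have hgm := Real.geom_mean_le_arith_mean2_weighted h1 h2 ha.le hb.le h3
  rw [h4] at hgm
  calc r ^ (-β) ≤ (a ^ ((b - r) / (b - a)) * b ^ ((r - a) / (b - a))) ^ (-β) :=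
        Real.rpow_le_rpow_of_nonpos (by positivity) hgm (by linarith)
    _ = (a ^ (-β)) ^ ((b - r) / (b - a)) * (b ^ (-β)) ^ ((r - a) / (b - a)) := by
        rw [Real.mul_rpow (by positivity) (by positivity), ← Real.rpow_mul ha.le,
          ← Real.rpow_mul hb.le, ← Real.rpow_mul ha.le, ← Real.rpow_mul hb.le]
        ring_nf
    _ ≤ _ := Real.geom_mean_le_arith_mean2_weighted h1 h2 (by positivity) (by positivity) h3

/-- The right half of the Hermite–Hadamard inequality for a negative power. -/
theorem integral_rpow_neg_le {a b β : ℝ} (ha : 0 < a) (hab : a < b) (hβ : 0 ≤ β) :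
    ∫ r in a..b, r ^ (-β) ≤ (b - a) * ((a ^ (-β) + b ^ (-β)) / 2) := by
  have hba : 0 < b - a := by linarith
  have hint : IntervalIntegrable (fun r : ℝ => r ^ (-β)) volume a b :=
    intervalIntegral.intervalIntegrable_rpow (Or.inr (by
      rw [Set.uIcc_of_le hab.le]; exact fun h => ha.not_ge h.1))
  calc ∫ r in a..b, r ^ (-β)
      ≤ ∫ r in a..b, ((b - r) / (b - a) * a ^ (-β) + (r - a) / (b - a) * b ^ (-β)) := by
        refine intervalIntegral.integral_mono_on hab.le hint
          (Continuous.intervalIntegrable (by fun_prop) _ _) fun r hr => ?_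
        exact rpow_neg_le_chord ha hr.1 hr.2 hab hβ
    _ = _ := by
        have h : ∀ r : ℝ, (b - r) / (b - a) * a ^ (-β) + (r - a) / (b - a) * b ^ (-β) =
            (b * a ^ (-β) - a * b ^ (-β)) / (b - a) + (b ^ (-β) - a ^ (-β)) / (b - a) * r :=
          fun r => by field_simp; ring
        simp_rw [h]
        rw [intervalIntegral.integral_add (by simp)
          (Continuous.intervalIntegrable (by fun_prop) _ _), intervalIntegral.integral_const_mul,
          integral_id, intervalIntegral.integral_const, smul_eq_mul]
        field_simp
        ring

/-- The part of the kernel close to the diagonal, after bounding the increment of the cutoff. -/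
def nearKernel (c α μ : ℝ) (z : ℝ × ℝ) : ℝ≥0∞ :=
  if z.1 - z.2 ∈ Set.Ioo 0 μ then ENNReal.ofReal (c * (z.1 - z.2) ^ (-α)) else 0

/-- The part of the kernel away from the diagonal, where the cutoff vanishes at the source. -/
def farKernel (η : ℝ → ℝ) (α μ : ℝ) (z : ℝ × ℝ) : ℝ≥0∞ :=
  if μ ≤ z.1 - z.2 then ENNReal.ofReal (|η z.1| * (z.1 - z.2) ^ (-α - 1)) else 0

theorem measurable_nearKernel (c α μ : ℝ) : Measurable (nearKernel c α μ) :=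
  Measurable.ite (measurableSet_Ioo.preimage (by fun_prop)) (by fun_prop) measurable_const

theorem measurable_farKernel {η : ℝ → ℝ} (hη : Measurable η) (α μ : ℝ) :
    Measurable (farKernel η α μ) :=
  Measurable.ite (measurableSet_Ici.preimage (f := fun z : ℝ × ℝ => z.1 - z.2) (by fun_prop))
    (by fun_prop) measurable_const

theorem lintegral_Ioo_rpow_neg {c α μ : ℝ} (hc : 0 ≤ c) (hα : α < 1) (hμ : 0 < μ) :
    ∫⁻ r in Set.Ioo 0 μ, ENNReal.ofReal (c * r ^ (-α)) =
      ENNReal.ofReal (c * (μ ^ (1 - α) / (1 - α))) := by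
  have hint : IntervalIntegrable (fun r : ℝ => c * r ^ (-α)) volume 0 μ :=
    (intervalIntegral.intervalIntegrable_rpow' (by linarith)).const_mul c
  rw [Measure.restrict_congr_set Ioo_ae_eq_Ioc, ← ofReal_integral_eq_lintegral_ofReal
      ((intervalIntegrable_iff_integrableOn_Ioc_of_le hμ.le).1 hint)
      ((ae_restrict_mem measurableSet_Ioc).mono fun r hr =>
        mul_nonneg hc (Real.rpow_nonneg hr.1.le _)),
    ← intervalIntegral.integral_of_le hμ.le, intervalIntegral.integral_const_mul,
    integral_rpow (Or.inl (by linarith)), Real.zero_rpow (by linarith), sub_zero,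
    neg_add_eq_sub]

theorem lintegral_indicator_Ioo_rpow_neg {c α μ : ℝ} (hc : 0 ≤ c) (hα : α < 1) (hμ : 0 < μ) :
    ∫⁻ r, (Set.Ioo 0 μ).indicator (fun r => ENNReal.ofReal (c * r ^ (-α))) r =
      ENNReal.ofReal (c * (μ ^ (1 - α) / (1 - α))) := by
  rw [lintegral_indicator measurableSet_Ioo, lintegral_Ioo_rpow_neg hc hα hμ]

theorem nearKernel_eq_indicator (c α μ t s : ℝ) : nearKernel c α μ (t, s) =
    (Set.Ioo 0 μ).indicator (fun r => ENNReal.ofReal (c * r ^ (-α))) (t - s) := by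
  simp [nearKernel, Set.indicator_apply]

theorem lintegral_nearKernel_right {c α μ : ℝ} (hc : 0 ≤ c) (hα : α < 1) (hμ : 0 < μ) (t : ℝ) :
    ∫⁻ s, nearKernel c α μ (t, s) = ENNReal.ofReal (c * (μ ^ (1 - α) / (1 - α))) := by
  simp_rw [nearKernel_eq_indicator]
  rw [lintegral_sub_left_eq_self
    ((Set.Ioo 0 μ).indicator fun r => ENNReal.ofReal (c * r ^ (-α))) t,
    lintegral_indicator_Ioo_rpow_neg hc hα hμ]

theorem lintegral_nearKernel_left {c α μ : ℝ} (hc : 0 ≤ c) (hα : α < 1) (hμ : 0 < μ) (s : ℝ) :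
    ∫⁻ t, nearKernel c α μ (t, s) = ENNReal.ofReal (c * (μ ^ (1 - α) / (1 - α))) := by
  simp_rw [nearKernel_eq_indicator]
  rw [lintegral_sub_right_eq_self
    ((Set.Ioo 0 μ).indicator fun r => ENNReal.ofReal (c * r ^ (-α))) s,
    lintegral_indicator_Ioo_rpow_neg hc hα hμ]

/-- A Lipschitz cutoff rising from `0` at `t₀ - μ` to `1` at `t₀ - ν`. -/
structure IsCutoff (η : ℝ → ℝ) (t₀ μ ν : ℝ) : Prop where
  lipschitz : LipschitzWith (Real.toNNReal (2 / (μ - ν))) η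
  eq_one : ∀ t, t₀ - ν ≤ t → η t = 1
  eq_zero : ∀ t, t ≤ t₀ - μ → η t = 0

namespace IsCutoff

variable {η : ℝ → ℝ} {t₀ μ ν : ℝ}

theorem abs_sub_le (h : IsCutoff η t₀ μ ν) (hνμ : ν < μ) (s t : ℝ) :
    |η s - η t| ≤ 2 / (μ - ν) * |s - t| := by
  have := h.lipschitz.dist_le_mul s t
  rwa [Real.dist_eq, Real.dist_eq, Real.coe_toNNReal _ (div_nonneg two_pos.le (by linarith))]
    at this

theorem abs_le (h : IsCutoff η t₀ μ ν) (hνμ : ν < μ) {t : ℝ} (ht : t₀ - μ ≤ t) :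
    |η t| ≤ 2 / (μ - ν) * (t - (t₀ - μ)) := by
  have := h.abs_sub_le hνμ t (t₀ - μ)
  rwa [h.eq_zero _ le_rfl, sub_zero, abs_of_nonneg (by linarith : 0 ≤ t - (t₀ - μ))] at this

theorem abs_le_two (h : IsCutoff η t₀ μ ν) (hνμ : ν < μ) (t : ℝ) : |η t| ≤ 2 := by
  have hm : 0 < μ - ν := by linarith
  rcases le_total t (t₀ - μ) with h1 | h1
  · simp [h.eq_zero t h1]
  rcases le_total (t₀ - ν) t with h2 | h2
  · simp [h.eq_one t h2]
  · refine (h.abs_le hνμ h1).trans ?_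
    rw [div_mul_eq_mul_div, div_le_iff₀ hm]
    linarith

theorem lintegral_abs_le (h : IsCutoff η t₀ μ ν) (hν : 0 < ν) (hνμ : ν < μ) :
    ∫⁻ t in Set.Ioo (t₀ - μ) t₀, ENNReal.ofReal |η t| ≤ ENNReal.ofReal μ := by
  have hm : 0 < μ - ν := by linarith
  have hcont : Continuous fun t => |η t| := h.lipschitz.continuous.abs
  rw [Measure.restrict_congr_set Ioo_ae_eq_Ioc, ← ofReal_integral_eq_lintegral_ofReal
      ((intervalIntegrable_iff_integrableOn_Ioc_of_le (by linarith)).1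
        (hcont.intervalIntegrable (t₀ - μ) t₀)) (ae_of_all _ fun t => abs_nonneg _),
    ← intervalIntegral.integral_of_le (by linarith),
    ← intervalIntegral.integral_add_adjacent_intervals
      (hcont.intervalIntegrable (t₀ - μ) (t₀ - ν)) (hcont.intervalIntegrable _ _)]
  refine ENNReal.ofReal_le_ofReal ?_
  have h1 : ∫ t in (t₀ - μ)..(t₀ - ν), |η t| ≤ μ - ν := by
    calc ∫ t in (t₀ - μ)..(t₀ - ν), |η t|
        ≤ ∫ t in (t₀ - μ)..(t₀ - ν), 2 / (μ - ν) * (t - (t₀ - μ)) :=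
          intervalIntegral.integral_mono_on (by linarith) (hcont.intervalIntegrable _ _)
            (Continuous.intervalIntegrable (by fun_prop) _ _) fun t ht => h.abs_le hνμ ht.1
      _ = μ - ν := by
          rw [intervalIntegral.integral_const_mul,
            intervalIntegral.integral_comp_sub_right (fun t => t), integral_id]
          field_simp
          ring
  have h2 : ∫ t in (t₀ - ν)..t₀, |η t| = ν := by
    rw [intervalIntegral.integral_congr (g := fun _ => (1 : ℝ))]
    · simp
    · intro t ht
      rw [Set.uIcc_of_le (by linarith)] at ht
      simp [h.eq_one t ht.1]
  linarith

/-- The bound for the far kernel at a source in `(t₀ - b, t₀ - a)`. -/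
theorem farKernel_le {α N a s t : ℝ} (hα : 0 < α) (hμ : 0 < μ) (hN : 1 ≤ N)
    (ha : a = μ ∨ (μ < a ∧ a ≤ N * (a - μ))) (ht : t₀ - μ < t) (hs : s < t₀ - a) :
    farKernel η α μ (t, s) ≤
      ENNReal.ofReal (N ^ (α + 1) * a ^ (-α - 1)) * ENNReal.ofReal |η t| := by
  have ha0 : 0 < a := by rcases ha with h | h <;> linarith
  have hN0 : 0 < N := by linarith
  unfold farKernel
  split_ifs with h
  · dsimp only at h ⊢
    rw [← ENNReal.ofReal_mul (by positivity), mul_comm]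
    refine ENNReal.ofReal_le_ofReal (mul_le_mul_of_nonneg_right ?_ (abs_nonneg _))
    have hle : a / N ≤ t - s := by
      rw [div_le_iff₀ hN0]
      rcases ha with rfl | ⟨h1, h2⟩
      · nlinarith
      · nlinarith
    calc (t - s) ^ (-α - 1) ≤ (a / N) ^ (-α - 1) :=
          Real.rpow_le_rpow_of_nonpos (by positivity) hle (by linarith)
      _ = N ^ (α + 1) * a ^ (-α - 1) := by
          rw [Real.div_rpow ha0.le hN0.le, div_eq_mul_inv, ← Real.rpow_neg hN0.le, mul_comm]
          ring_nf
  · exact zero_le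

theorem lintegral_farKernel_left_le (h : IsCutoff η t₀ μ ν) {α N a s : ℝ} (hν : 0 < ν)
    (hνμ : ν < μ) (hα : 0 < α) (hN : 1 ≤ N) (ha : a = μ ∨ (μ < a ∧ a ≤ N * (a - μ)))
    (hs : s < t₀ - a) :
    ∫⁻ t in Set.Ioo (t₀ - μ) t₀, farKernel η α μ (t, s) ≤
      ENNReal.ofReal ((N ^ (α + 1) + 1) * a ^ (-α - 1) * μ) := by
  have hμ : 0 < μ := hν.trans hνμ
  have ha0 : 0 < a := by rcases ha with h | h <;> linarith
  have hN0 : 0 < N := by linarith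
  calc ∫⁻ t in Set.Ioo (t₀ - μ) t₀, farKernel η α μ (t, s)
      ≤ ∫⁻ t in Set.Ioo (t₀ - μ) t₀,
          ENNReal.ofReal (N ^ (α + 1) * a ^ (-α - 1)) * ENNReal.ofReal |η t| :=
        setLIntegral_mono' measurableSet_Ioo fun t ht => farKernel_le hα hμ hN ha ht.1 hs
    _ ≤ ENNReal.ofReal (N ^ (α + 1) * a ^ (-α - 1)) * ENNReal.ofReal μ := by
        rw [lintegral_const_mul' _ _ ENNReal.ofReal_ne_top]
        gcongr
        exact h.lintegral_abs_le hν hνμ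
    _ ≤ _ := by
        rw [← ENNReal.ofReal_mul (by positivity)]
        gcongr
        linarith

theorem lintegral_farKernel_right_le (h : IsCutoff η t₀ μ ν) {α N a b t : ℝ}
    (hνμ : ν < μ) (hμ : 0 < μ) (hα : 0 < α) (hN : 1 ≤ N)
    (ha : a = μ ∨ (μ < a ∧ a ≤ N * (a - μ))) (hab : a + μ ≤ b) (ht : t₀ - μ < t) :
    ∫⁻ s in Set.Ioo (t₀ - b) (t₀ - a), farKernel η α μ (t, s) ≤
      ENNReal.ofReal ((N ^ (α + 1) + 1) * a ^ (-α - 1) * (b - a)) := by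
  have ha0 : 0 < a := by rcases ha with h | h <;> linarith
  have hN0 : 0 < N := by linarith
  have hN1 : 1 ≤ N ^ (α + 1) := Real.one_le_rpow hN (by linarith)
  rcases ha with rfl | ⟨h1, h2⟩
  · calc ∫⁻ s in Set.Ioo (t₀ - b) (t₀ - a), farKernel η α a (t, s)
        ≤ ∫⁻ s in Set.Ioo (t₀ - b) (t₀ - a), ENNReal.ofReal (2 * a ^ (-α - 1)) := by
          refine lintegral_mono fun s => ?_
          unfold farKernel
          split_ifs with hs
          · dsimp only at hs ⊢
            exact ENNReal.ofReal_le_ofReal (mul_le_mul (h.abs_le_two hνμ t)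
              (Real.rpow_le_rpow_of_nonpos ha0 hs (by linarith))
              (Real.rpow_nonneg (by linarith) _) two_pos.le)
          · exact zero_le
      _ = ENNReal.ofReal (2 * a ^ (-α - 1) * (b - a)) := by
          rw [setLIntegral_const, Real.volume_Ioo, ← ENNReal.ofReal_mul (by positivity)]
          ring_nf
      _ ≤ _ := by
          gcongr
          · linarith
          · linarith
  · have h3 : 0 < a - μ := by linarith
    have hint : IntervalIntegrable (fun r : ℝ => r ^ (-(α + 1))) volume (a - μ) (b - μ) :=
      intervalIntegral.intervalIntegrable_rpow (Or.inr (by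
        rw [Set.uIcc_of_le (by linarith)]; exact fun h => h3.not_ge h.1))
    have hpre : Set.Ioo (t₀ - b) (t₀ - a) =
        (fun s => t₀ - μ - s) ⁻¹' Set.Ioo (a - μ) (b - μ) := by
      ext s
      simp only [Set.mem_Ioo, Set.mem_preimage]
      constructor <;> rintro ⟨h4, h5⟩ <;> constructor <;> linarith
    have hkey : ∫⁻ s in Set.Ioo (t₀ - b) (t₀ - a),
        ENNReal.ofReal (2 * (t₀ - μ - s) ^ (-(α + 1))) =
        ENNReal.ofReal (2 * ∫ r in (a - μ)..(b - μ), r ^ (-(α + 1))) := by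
      rw [hpre, (Measure.measurePreserving_sub_left volume (t₀ - μ)).setLIntegral_comp_preimage
          (f := fun r => ENNReal.ofReal (2 * r ^ (-(α + 1)))) measurableSet_Ioo (by fun_prop),
        Measure.restrict_congr_set Ioo_ae_eq_Ioc, ← intervalIntegral.integral_const_mul,
        intervalIntegral.integral_of_le (by linarith), ofReal_integral_eq_lintegral_ofReal
        ((intervalIntegrable_iff_integrableOn_Ioc_of_le (by linarith)).1 (hint.const_mul 2))
        ((ae_restrict_mem measurableSet_Ioc).mono fun r hr =>
          mul_nonneg two_pos.le (Real.rpow_nonneg (h3.trans hr.1).le _))]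
    calc ∫⁻ s in Set.Ioo (t₀ - b) (t₀ - a), farKernel η α μ (t, s)
        ≤ ∫⁻ s in Set.Ioo (t₀ - b) (t₀ - a),
            ENNReal.ofReal (2 * (t₀ - μ - s) ^ (-(α + 1))) := by
          refine setLIntegral_mono' measurableSet_Ioo fun s hs => ?_
          unfold farKernel
          split_ifs with hst
          · dsimp only at hst ⊢
            have h4 : 0 < t₀ - μ - s := by linarith [hs.2]
            rw [show -α - 1 = -(α + 1) by ring]
            exact ENNReal.ofReal_le_ofReal (mul_le_mul (h.abs_le_two hνμ t)
              (Real.rpow_le_rpow_of_nonpos h4 (by linarith) (by linarith))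
              (Real.rpow_nonneg (by linarith) _) two_pos.le)
          · exact zero_le
      _ = ENNReal.ofReal (2 * ∫ r in (a - μ)..(b - μ), r ^ (-(α + 1))) := hkey
      _ ≤ _ := by
          refine ENNReal.ofReal_le_ofReal ?_
          have h5 := integral_rpow_neg_le (β := α + 1) h3 (by linarith : a - μ < b - μ)
            (by linarith)
          have h6 : (a - μ) ^ (-(α + 1)) ≤ N ^ (α + 1) * a ^ (-α - 1) := by
            calc (a - μ) ^ (-(α + 1)) ≤ (a / N) ^ (-(α + 1)) :=
                  Real.rpow_le_rpow_of_nonpos (by positivity)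
                    (by rw [div_le_iff₀ hN0]; linarith) (by linarith)
              _ = _ := by
                  rw [Real.div_rpow ha0.le hN0.le, div_eq_mul_inv, ← Real.rpow_neg hN0.le,
                    mul_comm]
                  ring_nf
          have h7 : (b - μ) ^ (-(α + 1)) ≤ a ^ (-α - 1) := by
            rw [show -α - 1 = -(α + 1) by ring]
            exact Real.rpow_le_rpow_of_nonpos ha0 (by linarith) (by linarith)
          have h8 := mul_le_mul_of_nonneg_left (add_le_add h6 h7) (by linarith : 0 ≤ b - a)
          linarith

end IsCutoff

theorem summable_rpow_neg_mul_sub {β N : ℝ} (hβ : 1 < β) (hN : 0 < N) {σ : ℕ → ℝ}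
    (hσ0 : 0 < σ 0) (hσ : Monotone σ) (hσN : ∀ k, σ (k + 1) ≤ N * σ k) :
    Summable fun k => σ k ^ (-β) * (σ (k + 1) - σ k) := by
  have hpos : ∀ k, 0 < σ k := fun k => hσ0.trans_le (hσ (zero_le))
  have hint : IntegrableOn (fun r : ℝ => r ^ (-β)) (Set.Ioi (σ 0)) :=
    integrableOn_Ioi_rpow_of_lt (by linarith) hσ0
  have hsum : Summable fun k => ∫ r in Set.Ioc (σ k) (σ (k + 1)), r ^ (-β) :=
    (hasSum_integral_iUnion (fun _ => measurableSet_Ioc) hσ.pairwise_disjoint_on_Ioc_succ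
      (hint.mono_set (Set.iUnion_subset fun k r hr => (hσ (zero_le)).trans_lt hr.1))).summable
  refine Summable.of_nonneg_of_le (fun k => mul_nonneg (Real.rpow_nonneg (hpos k).le _)
    (sub_nonneg.2 (hσ k.le_succ))) (fun k => ?_) (hsum.mul_left (N ^ β))
  have h1 : σ k ^ (-β) ≤ N ^ β * σ (k + 1) ^ (-β) := by
    calc σ k ^ (-β) ≤ (σ (k + 1) / N) ^ (-β) :=
          Real.rpow_le_rpow_of_nonpos (div_pos (hpos _) hN)
            (by rw [div_le_iff₀ hN]; linarith [hσN k]) (by linarith)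
      _ = _ := by
          rw [Real.div_rpow (hpos _).le hN.le, div_eq_mul_inv, ← Real.rpow_neg hN.le, neg_neg,
            mul_comm]
  have h2 : σ (k + 1) ^ (-β) * (σ (k + 1) - σ k) ≤
      ∫ r in Set.Ioc (σ k) (σ (k + 1)), r ^ (-β) := by
    have hle : ∫ r in Set.Ioc (σ k) (σ (k + 1)), σ (k + 1) ^ (-β) ≤
        ∫ r in Set.Ioc (σ k) (σ (k + 1)), r ^ (-β) :=
      setIntegral_mono_on (by simp)
        (hint.mono_set fun r hr => (hσ (zero_le)).trans_lt hr.1) measurableSet_Ioc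
        fun r hr => Real.rpow_le_rpow_of_nonpos ((hpos k).trans hr.1) hr.2 (by linarith)
    rw [setIntegral_const, smul_eq_mul, Real.volume_real_Ioc_of_le (hσ k.le_succ)] at hle
    linarith
  calc σ k ^ (-β) * (σ (k + 1) - σ k)
      ≤ N ^ β * σ (k + 1) ^ (-β) * (σ (k + 1) - σ k) := by
        gcongr
        exact sub_nonneg.2 (hσ k.le_succ)
    _ ≤ _ := by
        rw [mul_assoc]
        gcongr

theorem exists_mem_Ico_sub {σ : ℕ → ℝ} {t₀ μ s : ℝ} (hμ : 0 < μ)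
    (hσ : ∀ k, σ k + μ ≤ σ (k + 1)) (hs : s < t₀ - σ 0) :
    ∃ k, s ∈ Set.Ico (t₀ - σ (k + 1)) (t₀ - σ k) := by
  have hgrow : ∀ k : ℕ, σ 0 + k * μ ≤ σ k := fun k => by
    induction k with
    | zero => simp
    | succ k ih => push_cast; linarith [hσ k]
  have hex : ∃ n, t₀ - σ n ≤ s := by
    obtain ⟨n, hn⟩ := exists_nat_ge ((t₀ - σ 0 - s) / μ)
    rw [div_le_iff₀ hμ] at hn
    exact ⟨n, by linarith [hgrow n]⟩
  classical
  obtain ⟨k, hk⟩ : ∃ k, Nat.find hex = k + 1 := Nat.exists_eq_succ_of_ne_zero fun h0 => by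
    have := Nat.find_spec hex
    rw [h0] at this
    linarith
  refine ⟨k, hk ▸ Nat.find_spec hex, ?_⟩
  exact not_le.1 (Nat.find_min hex (by omega))

namespace IsCutoff

variable {η : ℝ → ℝ} {t₀ μ ν : ℝ}

theorem enorm_kernel_le (h : IsCutoff η t₀ μ ν) {α s t : ℝ} {σ : ℕ → ℝ} (hμ : 0 < μ)
    (hνμ : ν < μ) (hσ0 : σ 0 = μ) (hσ : ∀ k, σ k + μ ≤ σ (k + 1))
    (ht : t ∈ Set.Ioo (t₀ - μ) t₀) (hst : s < t) (w : ℝ≥0∞) :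
    ‖(t - s) ^ (-α - 1) * (η s - η t)‖ₑ * w ≤
      (Set.Ioo (t₀ - 2 * μ) (t₀ - ν)).indicator
          (fun s => nearKernel (2 / (μ - ν)) α μ (t, s) * w) s +
        ∑' k, (Set.Ico (t₀ - σ (k + 1)) (t₀ - σ k)).indicator
          (fun s => farKernel η α μ (t, s) * w) s := by
  have hts : 0 < t - s := sub_pos.2 hst
  have henorm : ‖(t - s) ^ (-α - 1) * (η s - η t)‖ₑ =
      ENNReal.ofReal (|η s - η t| * (t - s) ^ (-α - 1)) := by
    rw [Real.enorm_eq_ofReal_abs, abs_mul, abs_of_pos (Real.rpow_pos_of_pos hts _), mul_comm]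
  rw [henorm]
  rcases lt_or_ge (t - s) μ with hlt | hge
  · rcases lt_or_ge s (t₀ - ν) with hs | hs
    · refine le_add_right ?_
      have hmem : s ∈ Set.Ioo (t₀ - 2 * μ) (t₀ - ν) := ⟨by linarith [ht.1], hs⟩
      rw [Set.indicator_of_mem hmem, nearKernel, if_pos ⟨hts, hlt⟩]
      gcongr ENNReal.ofReal ?_ * _
      calc |η s - η t| * (t - s) ^ (-α - 1)
          ≤ 2 / (μ - ν) * (t - s) * (t - s) ^ (-α - 1) := by
            gcongr
            have := h.abs_sub_le hνμ s t
            rwa [abs_sub_comm s t, abs_of_pos hts] at this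
        _ = 2 / (μ - ν) * (t - s) ^ (-α) := by
            rw [Real.rpow_sub_one hts.ne']
            field_simp
    · simp [h.eq_one s hs, h.eq_one t (hs.trans hst.le)]
  · have hs0 : s < t₀ - μ := by linarith [ht.2]
    obtain ⟨k, hk⟩ := exists_mem_Ico_sub (t₀ := t₀) (s := s) hμ hσ (by rwa [hσ0])
    refine le_add_left (le_trans ?_ (ENNReal.le_tsum k))
    rw [Set.indicator_of_mem hk, farKernel, if_pos hge, h.eq_zero s hs0.le, zero_sub, abs_neg]

theorem lintegral_kernel_le (h : IsCutoff η t₀ μ ν) {α t : ℝ} {σ : ℕ → ℝ} (hμ : 0 < μ)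
    (hνμ : ν < μ) (hσ0 : σ 0 = μ) (hσ : ∀ k, σ k + μ ≤ σ (k + 1))
    (ht : t ∈ Set.Ioo (t₀ - μ) t₀) {w : ℝ → ℝ≥0∞} (hw : Measurable w) :
    ∫⁻ s in Set.Iio t, ‖(t - s) ^ (-α - 1) * (η s - η t)‖ₑ * w s ≤
      (∫⁻ s in Set.Ioo (t₀ - 2 * μ) (t₀ - ν), nearKernel (2 / (μ - ν)) α μ (t, s) * w s) +
        ∑' k, ∫⁻ s in Set.Ioo (t₀ - σ (k + 1)) (t₀ - σ k), farKernel η α μ (t, s) * w s := by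
  have hnear : Measurable fun s => nearKernel (2 / (μ - ν)) α μ (t, s) * w s :=
    ((measurable_nearKernel _ α μ).comp measurable_prodMk_left).mul hw
  have hfar : Measurable fun s => farKernel η α μ (t, s) * w s :=
    ((measurable_farKernel h.lipschitz.continuous.measurable α μ).comp
      measurable_prodMk_left).mul hw
  calc ∫⁻ s in Set.Iio t, ‖(t - s) ^ (-α - 1) * (η s - η t)‖ₑ * w s
      ≤ ∫⁻ s in Set.Iio t, ((Set.Ioo (t₀ - 2 * μ) (t₀ - ν)).indicator
            (fun s => nearKernel (2 / (μ - ν)) α μ (t, s) * w s) s +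
          ∑' k, (Set.Ico (t₀ - σ (k + 1)) (t₀ - σ k)).indicator
            (fun s => farKernel η α μ (t, s) * w s) s) := by
        refine setLIntegral_mono' measurableSet_Iio fun s hs => ?_
        exact h.enorm_kernel_le hμ hνμ hσ0 hσ ht hs (w s)
    _ ≤ ∫⁻ s, ((Set.Ioo (t₀ - 2 * μ) (t₀ - ν)).indicator
            (fun s => nearKernel (2 / (μ - ν)) α μ (t, s) * w s) s +
          ∑' k, (Set.Ico (t₀ - σ (k + 1)) (t₀ - σ k)).indicator
            (fun s => farKernel η α μ (t, s) * w s) s) := setLIntegral_le_lintegral _ _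
    _ = _ := by
        rw [lintegral_add_left (hnear.indicator measurableSet_Ioo),
          lintegral_tsum fun k => (hfar.indicator measurableSet_Ico).aemeasurable,
          lintegral_indicator measurableSet_Ioo]
        congr 1
        refine tsum_congr fun k => ?_
        rw [lintegral_indicator measurableSet_Ico,
          Measure.restrict_congr_set Ioo_ae_eq_Ico.symm]

/-- The `L_p` estimate for the integral operator with the absolute value of the kernel. -/
theorem lintegral_Lp_kernel_le (h : IsCutoff η t₀ μ ν) {X : Type*} [MeasurableSpace X]
    {ρ : Measure X} [SFinite ρ] {α p N : ℝ} {σ : ℕ → ℝ} (hα : α ∈ Set.Ioo (0 : ℝ) 1) (hp : 1 < p)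
    (hν : 0 < ν) (hνμ : ν < μ) (hN : 1 ≤ N) (hσ0 : σ 0 = μ) (hσ : ∀ k, σ k + μ ≤ σ (k + 1))
    (hσN : ∀ k, σ (k + 1) ≤ N * σ k) {w : ℝ × X → ℝ≥0∞} (hw : Measurable w) :
    (∫⁻ z, (∫⁻ s in Set.Iio z.1, ‖(z.1 - s) ^ (-α - 1) * (η s - η z.1)‖ₑ * w (s, z.2)) ^ p
        ∂((volume.restrict (Set.Ioo (t₀ - μ) t₀)).prod ρ)) ^ (1 / p) ≤
      ENNReal.ofReal (2 / (μ - ν) * (μ ^ (1 - α) / (1 - α))) *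
          (∫⁻ z, w z ^ p ∂((volume.restrict (Set.Ioo (t₀ - 2 * μ) (t₀ - ν))).prod ρ)) ^ (1 / p) +
        ∑' k, ENNReal.ofReal ((N ^ (α + 1) + 1) * (σ k ^ (-α - 1) *
            (σ (k + 1) - σ k) ^ (1 - 1 / p) * μ ^ (1 / p))) *
          (∫⁻ z, w z ^ p
            ∂((volume.restrict (Set.Ioo (t₀ - σ (k + 1)) (t₀ - σ k))).prod ρ)) ^ (1 / p) := by
  have hμ : 0 < μ := hν.trans hνμ
  have hp0 : 0 < p := by linarith
  have h1p : 0 ≤ 1 - 1 / p := by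
    rw [sub_nonneg, div_le_one hp0]; exact hp.le
  have hN0 : 0 < N := by linarith
  have hσpos : ∀ k, μ ≤ σ k := fun k => by
    induction k with
    | zero => exact hσ0.ge
    | succ k ih => linarith [hσ k]
  have ha : ∀ k, σ k = μ ∨ (μ < σ k ∧ σ k ≤ N * (σ k - μ)) := fun k => by
    cases k with
    | zero => exact Or.inl hσ0
    | succ k =>
      refine Or.inr ⟨by linarith [hσpos k, hσ k], (hσN k).trans ?_⟩
      gcongr
      linarith [hσ k]
  have hnearM := measurable_nearKernel (2 / (μ - ν)) α μ
  have hfarM := measurable_farKernel h.lipschitz.continuous.measurable α μ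
  have hc : 0 ≤ 2 / (μ - ν) := div_nonneg two_pos.le (by linarith)
  set τ := (volume.restrict (Set.Ioo (t₀ - μ) t₀)).prod ρ
  have hF : ∀ J : Set ℝ, Measurable fun z : ℝ × X =>
      ∫⁻ s in J, nearKernel (2 / (μ - ν)) α μ (z.1, s) * w (s, z.2) := fun J =>
    Measurable.lintegral_prod_right' (f := fun r : (ℝ × X) × ℝ =>
      nearKernel (2 / (μ - ν)) α μ (r.1.1, r.2) * w (r.2, r.1.2)) (by fun_prop)
  have hF' : ∀ J : Set ℝ, Measurable fun z : ℝ × X =>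
      ∫⁻ s in J, farKernel η α μ (z.1, s) * w (s, z.2) := fun J =>
    Measurable.lintegral_prod_right' (f := fun r : (ℝ × X) × ℝ =>
      farKernel η α μ (r.1.1, r.2) * w (r.2, r.1.2)) (by fun_prop)
  have hmem : ∀ᵐ z ∂τ, z.1 ∈ Set.Ioo (t₀ - μ) t₀ :=
    Measure.quasiMeasurePreserving_fst.ae (ae_restrict_mem measurableSet_Ioo)
  calc _ ≤ (∫⁻ z, ((∫⁻ s in Set.Ioo (t₀ - 2 * μ) (t₀ - ν),
            nearKernel (2 / (μ - ν)) α μ (z.1, s) * w (s, z.2)) +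
          ∑' k, ∫⁻ s in Set.Ioo (t₀ - σ (k + 1)) (t₀ - σ k),
            farKernel η α μ (z.1, s) * w (s, z.2)) ^ p ∂τ) ^ (1 / p) := by
        gcongr ?_ ^ (1 / p)
        refine lintegral_mono_ae (hmem.mono fun z hz => ?_)
        gcongr ?_ ^ p
        exact h.lintegral_kernel_le hμ hνμ hσ0 hσ hz (hw.comp measurable_prodMk_right)
    _ ≤ _ := by
        refine (ENNReal.lintegral_Lp_add_le (hF _).aemeasurable
          (Measurable.tsum fun k => hF' _).aemeasurable hp.le).trans (add_le_add ?_ ?_)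
        · refine (lintegral_Lp_schur_le hp hnearM hw
            (ae_of_all _ fun s => (setLIntegral_le_lintegral _ _).trans
              (lintegral_nearKernel_left hc hα.2 hμ s).le)
            (ae_of_all _ fun t => (setLIntegral_le_lintegral _ _).trans
              (lintegral_nearKernel_right hc hα.2 hμ t).le)).trans_eq ?_
          rw [← ENNReal.rpow_add_of_nonneg _ _ h1p (by positivity), sub_add_cancel,
            ENNReal.rpow_one]
        · refine (lintegral_Lp_tsum_le hp.le fun k => hF' _).trans
            (ENNReal.tsum_le_tsum fun k => ?_)
          have hσk : 0 < σ k := hμ.trans_le (hσpos k)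
          have hL : 0 < σ (k + 1) - σ k := by linarith [hσ k]
          refine (lintegral_Lp_schur_le hp hfarM hw
            ((ae_restrict_mem measurableSet_Ioo).mono fun s hs =>
              h.lintegral_farKernel_left_le hν hνμ hα.1 hN (ha k) hs.2)
            ((ae_restrict_mem measurableSet_Ioo).mono fun t ht =>
              h.lintegral_farKernel_right_le hνμ hμ hα.1 hN (ha k) (hσ k) ht.1)).trans_eq ?_
          rw [ENNReal.ofReal_rpow_of_nonneg (by positivity) h1p,
            ENNReal.ofReal_rpow_of_nonneg (by positivity) (by positivity),
            ← ENNReal.ofReal_mul (by positivity)]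
          congr 2
          have hC : 0 < (N ^ (α + 1) + 1) * σ k ^ (-α - 1) := by positivity
          rw [Real.mul_rpow hC.le hL.le, Real.mul_rpow hC.le hμ.le, mul_mul_mul_comm,
            ← Real.rpow_add hC, sub_add_cancel, Real.rpow_one]
          ring

end IsCutoff

theorem summable_rpow_mul_integral_rpow {X : Type*} [MeasurableSpace X] {m : Measure X}
    {α p N : ℝ} (hα : 0 < α) (hp : 1 < p) (hN : 0 < N) {σ : ℕ → ℝ} (hσ0 : 0 < σ 0)
    (hσ : Monotone σ) (hσN : ∀ k, σ (k + 1) ≤ N * σ k) {f : X → ℝ} (hf : ∀ x, 0 ≤ f x)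
    {S : ℕ → Set X} (hS : ∀ k, MeasurableSet (S k)) (hSd : Pairwise (Function.onFun Disjoint S))
    (hfi : IntegrableOn f (⋃ k, S k) m) :
    Summable fun k => σ k ^ (-α - 1) * (σ (k + 1) - σ k) ^ (1 - 1 / p) *
      (∫ x in S k, f x ∂m) ^ (1 / p) := by
  have hp0 : 0 < p := by linarith
  have hpq : p.HolderConjugate p.conjExponent := Real.HolderConjugate.conjExponent hp
  set q := p.conjExponent
  have hq : 1 - 1 / p = 1 / q := by
    have := hpq.inv_add_inv_eq_one
    simp only [one_div]; linarith
  have hq1 : 1 < q := hpq.symm.lt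
  have hpos : ∀ k, 0 < σ k := fun k => hσ0.trans_le (hσ zero_le)
  have hL : ∀ k, 0 ≤ σ (k + 1) - σ k := fun k => sub_nonneg.2 (hσ k.le_succ)
  have hI : ∀ k, 0 ≤ ∫ x in S k, f x ∂m := fun k => integral_nonneg hf
  refine Real.summable_mul_of_Lp_Lq_of_nonneg hpq.symm
    (fun k => mul_nonneg (Real.rpow_nonneg (hpos k).le _) (Real.rpow_nonneg (hL k) _))
    (fun k => Real.rpow_nonneg (hI k) _) ?_ ?_
  · refine (summable_rpow_neg_mul_sub (β := (α + 1) * q) (by nlinarith) hN hσ0 hσ hσN).congr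
      fun k => ?_
    rw [hq, Real.mul_rpow (Real.rpow_nonneg (hpos k).le _) (Real.rpow_nonneg (hL k) _),
      ← Real.rpow_mul (hpos k).le, ← Real.rpow_mul (hL k), one_div_mul_cancel (by linarith),
      Real.rpow_one]
    ring_nf
  · refine (hasSum_integral_iUnion hS hSd hfi).summable.congr fun k => ?_
    rw [← Real.rpow_mul (hI k), one_div_mul_cancel hp0.ne', Real.rpow_one]

theorem enorm_rpow_eq_ofReal {p : ℝ} (hp : 0 ≤ p) (y : ℝ) :
    ‖y‖ₑ ^ p = ENNReal.ofReal (|y| ^ p) := by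
  rw [Real.enorm_eq_ofReal_abs, ENNReal.ofReal_rpow_of_nonneg (abs_nonneg y) hp]

theorem aemeasurable_enorm_of_integrable_abs_rpow {X : Type*} [MeasurableSpace X] {m : Measure X}
    {p : ℝ} (hp : 0 < p) {f : X → ℝ} (hf : Integrable (fun x => |f x| ^ p) m) :
    AEMeasurable (fun x => ‖f x‖ₑ) m := by
  have h : (fun x => ‖f x‖ₑ) = fun x => ENNReal.ofReal ((|f x| ^ p) ^ (1 / p)) := by
    ext x
    rw [← Real.rpow_mul (abs_nonneg _), mul_one_div_cancel hp.ne', Real.rpow_one,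
      Real.enorm_eq_ofReal_abs]
  rw [h]
  exact (hf.aemeasurable.pow_const _).ennreal_ofReal

/-- Lemma A.1: `L_p` estimate for the commutator-type kernel term
`G(t,x) = (α/Γ(1-α)) ∫_{-∞}^t (t-s)^{-α-1} (η(s) - η(t)) u(s,x) ds`. -/
theorem statement17 (d : ℕ) (t₀ α p ν μ N₀ : ℝ)
    (hα : α ∈ Set.Ioo (0 : ℝ) 1) (hp : 1 < p) (hν : 0 < ν) (hνμ : ν < μ) (hN₀ : 0 < N₀)
    (Ω : Set (EuclideanSpace ℝ (Fin d))) (hΩ : MeasurableSet Ω)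
    (u : ℝ → EuclideanSpace ℝ (Fin d) → ℝ)
    (hu : IntegrableOn (fun q : ℝ × EuclideanSpace ℝ (Fin d) => |u q.1 q.2| ^ p)
      (Set.Iio t₀ ×ˢ Ω))
    (η : ℝ → ℝ)
    (hηLip : LipschitzWith (Real.toNNReal (2 / (μ - ν))) η)
    (hη1 : ∀ t, t₀ - ν ≤ t → η t = 1) (hη0 : ∀ t, t ≤ t₀ - μ → η t = 0)
    (G : ℝ → EuclideanSpace ℝ (Fin d) → ℝ)
    (hG : ∀ (t : ℝ) (x : EuclideanSpace ℝ (Fin d)),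
      G t x = α / Real.Gamma (1 - α) *
        ∫ s in Set.Iio t, (t - s) ^ (-α - 1) * (η s - η t) * u s x)
    (s : ℕ → ℝ) (hs1 : s 1 = μ)
    (hsmono : ∀ k : ℕ, 1 ≤ k → s k + μ ≤ s (k + 1))
    (hsN : ∀ k : ℕ, 1 ≤ k → s (k + 1) ≤ N₀ * s k) :
    (∫ q in Set.Ioo (t₀ - μ) t₀ ×ˢ Ω, |G q.1 q.2| ^ p) ^ (1 / p) ≤
      2 * α * μ ^ (1 - α) / ((1 - α) * Real.Gamma (1 - α) * (μ - ν)) *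
          (∫ q in Set.Ioo (t₀ - 2 * μ) (t₀ - ν) ×ˢ Ω, |u q.1 q.2| ^ p) ^ (1 / p) +
        α * (N₀ ^ (α + 1) + 1) / Real.Gamma (1 - α) *
          ∑' k : ℕ,
            s (k + 1) ^ (-α - 1) * (s (k + 2) - s (k + 1)) ^ (1 - 1 / p) * μ ^ (1 / p) *
              (∫ q in Set.Ioo (t₀ - s (k + 2)) (t₀ - s (k + 1)) ×ˢ Ω,
                  |u q.1 q.2| ^ p) ^ (1 / p) := by
  have hμ : 0 < μ := hν.trans hνμ
  have hp0 : 0 < p := by linarith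
  have hΓ : 0 < Real.Gamma (1 - α) := Real.Gamma_pos_of_pos (by linarith [hα.2])
  have h1α : 0 < 1 - α := by linarith [hα.2]
  have hμν : 0 < μ - ν := by linarith
  have hcut : IsCutoff η t₀ μ ν := ⟨hηLip, hη1, hη0⟩
  obtain ⟨σ, hσs⟩ : ∃ σ : ℕ → ℝ, ∀ k, s (k + 1) = σ k := ⟨fun k => s (k + 1), fun _ => rfl⟩
  have hσ0 : σ 0 = μ := by rw [← hσs, hs1]
  have hσ : ∀ k, σ k + μ ≤ σ (k + 1) := fun k => by
    simpa only [hσs] using hsmono (k + 1) (by omega)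
  have hσN : ∀ k, σ (k + 1) ≤ N₀ * σ k := fun k => by
    simpa only [hσs] using hsN (k + 1) (by omega)
  simp only [hσs]
  have hσmono : Monotone σ := monotone_nat_of_le_succ fun k => by linarith [hσ k]
  have hσpos : ∀ k, 0 < σ k := fun k => (hσ0 ▸ hμ).trans_le (hσmono zero_le)
  have hL : ∀ k, 0 < σ (k + 1) - σ k := fun k => by linarith [hσ k]
  have hN : 1 ≤ N₀ := by
    have h1 := hσ 0
    have h2 := hσN 0
    rw [hσ0] at h1 h2
    by_contra! hlt
    nlinarith
  set ρ := (volume : Measure (EuclideanSpace ℝ (Fin d))).restrict Ω with hρ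
  have hprod : ∀ J : Set ℝ, (volume : Measure (ℝ × EuclideanSpace ℝ (Fin d))).restrict (J ×ˢ Ω) =
      (volume.restrict J).prod ρ := fun J => by
    rw [Measure.volume_eq_prod, hρ, Measure.prod_restrict]
  have hu' := hu
  simp only [IntegrableOn, hprod] at hu'
  have hum : AEMeasurable (fun q : ℝ × EuclideanSpace ℝ (Fin d) => ‖u q.1 q.2‖ₑ)
      ((volume.restrict (Set.Iio t₀)).prod ρ) := aemeasurable_enorm_of_integrable_abs_rpow hp0 hu'
  obtain ⟨w, hw, huw⟩ := hum
  have hnorm : ∀ J ⊆ Set.Iio t₀, ∫⁻ z, w z ^ p ∂((volume.restrict J).prod ρ) =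
      ENNReal.ofReal (∫ q in J ×ˢ Ω, |u q.1 q.2| ^ p) := fun J hJ => by
    rw [ofReal_integral_eq_lintegral_ofReal (hu.mono_set (Set.prod_mono_left hJ))
      (ae_of_all _ fun q => Real.rpow_nonneg (abs_nonneg _) _), hprod]
    refine lintegral_congr_ae ?_
    have hle : (volume.restrict J).prod ρ ≤ (volume.restrict (Set.Iio t₀)).prod ρ := by
      rw [← hprod, ← hprod]
      exact Measure.restrict_mono (Set.prod_mono_left hJ) le_rfl
    filter_upwards [ae_mono hle huw] with z hz
    rw [← hz, enorm_rpow_eq_ofReal hp0.le]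
  have hslice : ∀ᵐ x ∂ρ, ∀ᵐ s ∂(volume.restrict (Set.Iio t₀)), ‖u s x‖ₑ = w (s, x) :=
    Measure.ae_ae_of_ae_prod
      ((Measure.measurePreserving_swap (μ := ρ)
        (ν := volume.restrict (Set.Iio t₀))).quasiMeasurePreserving.ae huw)
  have hGle : ∀ᵐ z ∂((volume.restrict (Set.Ioo (t₀ - μ) t₀)).prod ρ), ‖G z.1 z.2‖ₑ ≤
      ENNReal.ofReal (α / Real.Gamma (1 - α)) * ∫⁻ s in Set.Iio z.1,
        ‖(z.1 - s) ^ (-α - 1) * (η s - η z.1)‖ₑ * w (s, z.2) := by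
    filter_upwards [Measure.quasiMeasurePreserving_snd.ae hslice,
      Measure.quasiMeasurePreserving_fst.ae (ae_restrict_mem measurableSet_Ioo)] with z hz hz1
    rw [hG, enorm_mul, Real.enorm_of_nonneg (div_nonneg hα.1.le hΓ.le)]
    gcongr
    refine (enorm_integral_le_lintegral_enorm _).trans_eq (lintegral_congr_ae ?_)
    filter_upwards [ae_mono (Measure.restrict_mono (Set.Iio_subset_Iio hz1.2.le) le_rfl) hz]
      with s hs
    rw [enorm_mul, hs]
  have hsum : Summable fun k => σ k ^ (-α - 1) * (σ (k + 1) - σ k) ^ (1 - 1 / p) * μ ^ (1 / p) *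
      (∫ q in Set.Ioo (t₀ - σ (k + 1)) (t₀ - σ k) ×ˢ Ω, |u q.1 q.2| ^ p) ^ (1 / p) := by
    have hdisj : Pairwise (Function.onFun Disjoint
        fun k => Set.Ioo (t₀ - σ (k + 1)) (t₀ - σ k) ×ˢ Ω) := fun i j hij =>
      Set.disjoint_left.2 fun q hqi hqj => by
        have hi := hqi.1
        have hj := hqj.1
        simp only [Set.mem_Ioo] at hi hj
        rcases lt_or_gt_of_ne hij with h | h
        · linarith [hσmono (Nat.succ_le_of_lt h), hi.1, hj.2]
        · linarith [hσmono (Nat.succ_le_of_lt h), hj.1, hi.2]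
    refine ((summable_rpow_mul_integral_rpow hα.1 hp hN₀ (hσpos 0) hσmono hσN
      (f := fun q : ℝ × EuclideanSpace ℝ (Fin d) => |u q.1 q.2| ^ p)
      (fun q => Real.rpow_nonneg (abs_nonneg _) _)
      (fun k => measurableSet_Ioo.prod hΩ) hdisj
      (hu.mono_set (Set.iUnion_subset fun k => Set.prod_mono_left fun r hr => ?_))).mul_left
        (μ ^ (1 / p))).congr fun k => by ring
    simp only [Set.mem_Iio]
    linarith [hr.2, hσpos k]
  have hI : ∀ J : Set ℝ, 0 ≤ ∫ q in J ×ˢ Ω, |u q.1 q.2| ^ p := fun J =>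
    integral_nonneg fun q => Real.rpow_nonneg (abs_nonneg _) _
  have hT : ∀ k, 0 ≤ σ k ^ (-α - 1) * (σ (k + 1) - σ k) ^ (1 - 1 / p) * μ ^ (1 / p) := fun k => by
    have := hσpos k
    have := hL k
    positivity
  have hterm := fun k => mul_nonneg (hT k)
    (Real.rpow_nonneg (hI (Set.Ioo (t₀ - σ (k + 1)) (t₀ - σ k))) (1 / p))
  have hIG : 0 ≤ ∫ q in Set.Ioo (t₀ - μ) t₀ ×ˢ Ω, |G q.1 q.2| ^ p :=
    integral_nonneg fun q => Real.rpow_nonneg (abs_nonneg _) _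
  have hC : 0 ≤ N₀ ^ (α + 1) + 1 := by positivity
  have hc0 : 0 ≤ α / Real.Gamma (1 - α) := div_nonneg hα.1.le hΓ.le
  have hD : 0 ≤ 2 / (μ - ν) * (μ ^ (1 - α) / (1 - α)) := by positivity
  have hnear := Real.rpow_nonneg (hI (Set.Ioo (t₀ - 2 * μ) (t₀ - ν))) (1 / p)
  have hfinal : 2 * α * μ ^ (1 - α) / ((1 - α) * Real.Gamma (1 - α) * (μ - ν)) *
        (∫ q in Set.Ioo (t₀ - 2 * μ) (t₀ - ν) ×ˢ Ω, |u q.1 q.2| ^ p) ^ (1 / p) +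
      α * (N₀ ^ (α + 1) + 1) / Real.Gamma (1 - α) * ∑' k : ℕ,
        σ k ^ (-α - 1) * (σ (k + 1) - σ k) ^ (1 - 1 / p) * μ ^ (1 / p) *
          (∫ q in Set.Ioo (t₀ - σ (k + 1)) (t₀ - σ k) ×ˢ Ω, |u q.1 q.2| ^ p) ^ (1 / p) =
      α / Real.Gamma (1 - α) * (2 / (μ - ν) * (μ ^ (1 - α) / (1 - α)) *
        (∫ q in Set.Ioo (t₀ - 2 * μ) (t₀ - ν) ×ˢ Ω, |u q.1 q.2| ^ p) ^ (1 / p) +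
      ∑' k : ℕ, (N₀ ^ (α + 1) + 1) *
        (σ k ^ (-α - 1) * (σ (k + 1) - σ k) ^ (1 - 1 / p) * μ ^ (1 / p) *
          (∫ q in Set.Ioo (t₀ - σ (k + 1)) (t₀ - σ k) ×ˢ Ω, |u q.1 q.2| ^ p) ^ (1 / p))) := by
    rw [tsum_mul_left]
    generalize ∑' k : ℕ, σ k ^ (-α - 1) * (σ (k + 1) - σ k) ^ (1 - 1 / p) * μ ^ (1 / p) *
      (∫ q in Set.Ioo (t₀ - σ (k + 1)) (t₀ - σ k) ×ˢ Ω, |u q.1 q.2| ^ p) ^ (1 / p) = Z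
    field_simp
  have hsum' := hsum.mul_left (N₀ ^ (α + 1) + 1)
  have hterm' := fun k => mul_nonneg hC (hterm k)
  rw [hfinal, ← ENNReal.ofReal_le_ofReal_iff
    (mul_nonneg hc0 (add_nonneg (mul_nonneg hD hnear) (tsum_nonneg hterm')))]
  calc ENNReal.ofReal ((∫ q in Set.Ioo (t₀ - μ) t₀ ×ˢ Ω, |G q.1 q.2| ^ p) ^ (1 / p))
      = ENNReal.ofReal (∫ q in Set.Ioo (t₀ - μ) t₀ ×ˢ Ω, |G q.1 q.2| ^ p) ^ (1 / p) :=
        (ENNReal.ofReal_rpow_of_nonneg hIG (by positivity)).symm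
    _ ≤ (∫⁻ z, ‖G z.1 z.2‖ₑ ^ p ∂((volume.restrict (Set.Ioo (t₀ - μ) t₀)).prod ρ)) ^
          (1 / p) := by
        gcongr ?_ ^ (1 / p)
        refine (Real.ofReal_le_enorm _).trans ((enorm_integral_le_lintegral_enorm _).trans_eq ?_)
        rw [hprod]
        refine lintegral_congr fun z => ?_
        rw [enorm_rpow_eq_ofReal hp0.le, Real.enorm_of_nonneg (by positivity)]
    _ ≤ (∫⁻ z, ENNReal.ofReal (α / Real.Gamma (1 - α)) ^ p * (∫⁻ s in Set.Iio z.1,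
          ‖(z.1 - s) ^ (-α - 1) * (η s - η z.1)‖ₑ * w (s, z.2)) ^ p
          ∂((volume.restrict (Set.Ioo (t₀ - μ) t₀)).prod ρ)) ^ (1 / p) := by
        gcongr ?_ ^ (1 / p)
        refine lintegral_mono_ae (hGle.mono fun z hz => ?_)
        rw [← ENNReal.mul_rpow_of_nonneg _ _ hp0.le]
        gcongr
    _ = ENNReal.ofReal (α / Real.Gamma (1 - α)) * (∫⁻ z, (∫⁻ s in Set.Iio z.1,
          ‖(z.1 - s) ^ (-α - 1) * (η s - η z.1)‖ₑ * w (s, z.2)) ^ p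
          ∂((volume.restrict (Set.Ioo (t₀ - μ) t₀)).prod ρ)) ^ (1 / p) := by
        rw [lintegral_const_mul' _ _ (by finiteness),
          ENNReal.mul_rpow_of_nonneg _ _ (by positivity), ← ENNReal.rpow_mul,
          mul_one_div_cancel hp0.ne', ENNReal.rpow_one]
    _ ≤ _ := by
        rw [ENNReal.ofReal_mul hc0, ENNReal.ofReal_add (mul_nonneg hD hnear) (tsum_nonneg hterm'),
          ENNReal.ofReal_mul hD, ENNReal.ofReal_tsum_of_nonneg hterm' hsum']
        gcongr
        refine (hcut.lintegral_Lp_kernel_le hα hp hν hνμ hN hσ0 hσ hσN hw).trans_eq ?_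
        congr 1
        · rw [hnorm _ fun r hr => by simp only [Set.mem_Iio]; linarith [hr.2],
            ENNReal.ofReal_rpow_of_nonneg (hI _) (by positivity)]
        · refine tsum_congr fun k => ?_
          rw [hnorm _ fun r hr => by simp only [Set.mem_Iio]; linarith [hr.2, hσpos k],
            ENNReal.ofReal_rpow_of_nonneg (hI _) (by positivity),
            ← ENNReal.ofReal_mul (mul_nonneg hC (hT k)), mul_assoc (N₀ ^ (α + 1) + 1)]

end
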